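/- Let E : ℝ×ℝ×ℝ³ → ℝ³ be C² with bounded derivatives and 2π-periodic in its second argument, and let (Y¹,U¹) solve, with Y¹(s) = 0, U¹(s) = 0: dY¹/dt = U¹_∥ + (1/2π)∫₀^{2π}(∫₀^θ dσ − (θ/2π)∫₀^{2π} dσ)(R(θ−σ)E(t,σ,Y⁰)) dθ − (R(π/2)−P)(1/2π)∫₀^{2π} R(−ς)E(t,ς,Y⁰) dς, and dU¹/dt = [(1/2π)∫₀^{2π} R(−θ)∇_xE(t,θ,Y⁰) dθ] Y¹ + [(1/2π)∫₀^{2π} R(−θ)∇_xE(t,θ,Y⁰)𝓡(θ) dθ] U⁰ − [(1/2π)∫₀^{2π}(∫₀^θ dσ − (θ/2π)∫₀^{2π} dσ)(R(−σ)∇_xE(t,σ,Y⁰)) dθ] U⁰_∥ − (1/2π)∫₀^{2π}(∫₀^θ dσ − (θ/2π)∫₀^{2π} dσ)(R(−σ)∂_tE(t,σ,Y⁰)) dθ. Then for every T > 0, lim_{ε→0} sup_{t∈[s,s+T]} |(1/ε)(X_ε(t) − Y⁰(t)) − (Y¹(t) + 𝓡((t−s)/ε)U⁰(t))| = 0 and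 lim_{ε→0} sup_{t∈[s,s+T]} |(1/ε)(V_ε(t) − R((t−s)/ε)U⁰(t)) − R((t−s)/ε)[U¹(t) + (∫₀^{(t−s)/ε} dσ − (((t−s)/ε)/2π)∫₀^{2π} dσ)(R(−σ)E(t,σ,Y⁰(t)))]| = 0. -/

import Mathlib

open Real Set Filter Matrix MeasureTheory intervalIntegral

/-- The rotation matrix of angle `-θ` around the first axis. -/
noncomputable def Rrot (θ : ℝ) : Matrix (Fin 3) (Fin 3) ℝ :=
  !![1, 0, 0; 0, Real.cos θ, Real.sin θ; 0, -Real.sin θ, Real.cos θ]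

/-- The matrix `𝓡(θ)`. -/
noncomputable def scrR (θ : ℝ) : Matrix (Fin 3) (Fin 3) ℝ :=
  !![0, 0, 0; 0, Real.sin θ, 1 - Real.cos θ; 0, Real.cos θ - 1, Real.sin θ]

/-- The orthogonal projection onto the first axis. -/
noncomputable def Pmat : Matrix (Fin 3) (Fin 3) ℝ := !![1, 0, 0; 0, 0, 0; 0, 0, 0]

/-- The first vector of the canonical basis of `ℝ³`. -/
noncomputable def ee1 : Fin 3 → ℝ := ![1, 0, 0]

/-- The third vector of the canonical basis of `ℝ³`. -/
noncomputable def ee3 : Fin 3 → ℝ := ![0, 0, 1]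

/-- The component of `v` parallel to the first axis: `v_∥ = (v·e₁)e₁`. -/
noncomputable def vpar (v : Fin 3 → ℝ) : Fin 3 → ℝ := ![v 0, 0, 0]

/-- The cross product on `ℝ³`. -/
def cross3 (u v : Fin 3 → ℝ) : Fin 3 → ℝ :=
  ![u 1 * v 2 - u 2 * v 1, u 2 * v 0 - u 0 * v 2, u 0 * v 1 - u 1 * v 0]

/-- The Euclidean norm on `ℝ³`. -/
noncomputable def euclN (v : Fin 3 → ℝ) : ℝ := Real.sqrt (v 0 ^ 2 + v 1 ^ 2 + v 2 ^ 2)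

section Averaging

/-- A jointly continuous function, periodic in its second variable, is uniformly continuous in its
first variable on compact intervals. -/
lemma exists_modulus_of_periodic {G : Type*} [NormedAddCommGroup G]
    {h : ℝ → ℝ → G} {c : ℝ} (hc : 0 < c)
    (hcont : Continuous (Function.uncurry h)) (hper : ∀ t, Function.Periodic (h t) c)
    (a b : ℝ) {δ : ℝ} (hδ : 0 < δ) :
    ∃ ρ > 0, ∀ t ∈ Icc a b, ∀ r ∈ Icc a b, |t - r| < ρ → ∀ θ, ‖h t θ - h r θ‖ < δ := by
  have huc := ((isCompact_Icc (a := a) (b := b)).prod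
    (isCompact_Icc (a := 0) (b := c))).uniformContinuousOn_of_continuous hcont.continuousOn
  obtain ⟨ρ, hρ, H⟩ := Metric.uniformContinuousOn_iff.1 huc δ hδ
  refine ⟨ρ, hρ, fun t ht r hr htr θ => ?_⟩
  have hp : Function.Periodic (fun θ t => h t θ) c := fun θ => funext fun t => hper t θ
  obtain ⟨y, hy, hθ⟩ := hp.exists_mem_Ico₀ hc θ
  have := H (t, y) ⟨ht, Ico_subset_Icc_self hy⟩ (r, y) ⟨hr, Ico_subset_Icc_self hy⟩
    (by simpa [Prod.dist_eq, Real.dist_eq] using htr)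
  rw [dist_eq_norm] at this
  rw [congrFun hθ t, congrFun hθ r]
  exact this

lemma exists_bound_of_periodic {G : Type*} [NormedAddCommGroup G]
    {h : ℝ → ℝ → G} {c : ℝ} (hc : 0 < c)
    (hcont : Continuous (Function.uncurry h)) (hper : ∀ t, Function.Periodic (h t) c)
    (a b : ℝ) : ∃ M, 0 ≤ M ∧ ∀ t ∈ Icc a b, ∀ θ, ‖h t θ‖ ≤ M := by
  obtain ⟨M, hM⟩ := ((isCompact_Icc (a := a) (b := b)).prod
    (isCompact_Icc (a := 0) (b := c))).exists_bound_of_continuousOn hcont.continuousOn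
  refine ⟨max M 0, le_max_right _ _, fun t ht θ => ?_⟩
  obtain ⟨y, hy, hθ⟩ := (hper t).exists_mem_Ico₀ hc θ
  rw [hθ]
  exact (hM (t, y) ⟨ht, Ico_subset_Icc_self hy⟩).trans (le_max_left _ _)

variable {G : Type*} [NormedAddCommGroup G] [NormedSpace ℝ G]

/-- The mean of a `2π`-periodic function over one period. -/
noncomputable def periodMean (g : ℝ → G) : G := (2 * π)⁻¹ • ∫ θ in (0:ℝ)..(2 * π), g θ

/-- The primitive of `g` from `0`, corrected by a linear term so as to vanish at `2π`. -/
noncomputable def oscPrim (g : ℝ → G) (θ : ℝ) : G :=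
  (∫ σ in (0:ℝ)..θ, g σ) - (θ / (2 * π)) • ∫ σ in (0:ℝ)..(2 * π), g σ

lemma oscPrim_eq (g : ℝ → G) (θ : ℝ) :
    oscPrim g θ = (∫ σ in (0:ℝ)..θ, g σ) - θ • periodMean g := by
  simp [oscPrim, periodMean, smul_smul, div_eq_mul_inv]

lemma oscPrim_zero (g : ℝ → G) : oscPrim g 0 = 0 := by simp [oscPrim]

lemma oscPrim_two_pi (g : ℝ → G) : oscPrim g (2 * π) = 0 := by
  simp [oscPrim]

lemma oscPrim_add_two_pi {g : ℝ → G} (hg : Continuous g) (hp : Function.Periodic g (2 * π))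
    (θ : ℝ) : oscPrim g (θ + 2 * π) = oscPrim g θ := by
  have h1 : ∫ σ in (0:ℝ)..(θ + 2 * π), g σ
      = (∫ σ in (0:ℝ)..θ, g σ) + ∫ σ in (0:ℝ)..(2 * π), g σ := by
    rw [← integral_add_adjacent_intervals (hg.intervalIntegrable 0 θ)
      (hg.intervalIntegrable θ (θ + 2 * π)), hp.intervalIntegral_add_eq θ 0, zero_add]
  rw [oscPrim, oscPrim, h1, add_div, div_self Real.two_pi_pos.ne', add_smul, one_smul]
  abel

lemma continuous_oscPrim {X : Type*} [TopologicalSpace X] {g : X → ℝ → G}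
    (hg : Continuous (Function.uncurry g)) :
    Continuous fun p : X × ℝ => oscPrim (g p.1) p.2 := by
  unfold oscPrim
  have h1 := continuous_parametric_primitive_of_continuous (μ := volume) (a₀ := 0) hg
  have h2 := continuous_parametric_intervalIntegral_of_continuous' (μ := volume) hg 0 (2 * π)
  exact h1.sub ((continuous_snd.div_const _).smul (h2.comp continuous_fst))

lemma continuous_periodMean {X : Type*} [TopologicalSpace X] {g : X → ℝ → G}
    (hg : Continuous (Function.uncurry g)) : Continuous fun x : X => periodMean (g x) := by
  unfold periodMean
  exact (continuous_parametric_intervalIntegral_of_continuous' (μ := volume) hg 0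
    (2 * π)).const_smul _

lemma periodMean_add {f g : ℝ → G} (hf : Continuous f) (hg : Continuous g) :
    periodMean (fun θ => f θ + g θ) = periodMean f + periodMean g := by
  rw [periodMean, intervalIntegral.integral_add (hf.intervalIntegrable _ _)
    (hg.intervalIntegrable _ _), smul_add, periodMean, periodMean]

lemma periodMean_sub {f g : ℝ → G} (hf : Continuous f) (hg : Continuous g) :
    periodMean (fun θ => f θ - g θ) = periodMean f - periodMean g := by
  rw [periodMean, intervalIntegral.integral_sub (hf.intervalIntegrable _ _)
    (hg.intervalIntegrable _ _), smul_sub, periodMean, periodMean]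

lemma oscPrim_add {f g : ℝ → G} (hf : Continuous f) (hg : Continuous g) (θ : ℝ) :
    oscPrim (fun σ => f σ + g σ) θ = oscPrim f θ + oscPrim g θ := by
  rw [oscPrim_eq, oscPrim_eq, oscPrim_eq, periodMean_add hf hg,
    intervalIntegral.integral_add (hf.intervalIntegrable _ _) (hg.intervalIntegrable _ _),
    smul_add]
  abel

/-- The Leibniz rule for an integral with fixed end points, under joint continuity. -/
lemma hasDerivAt_integral_of_continuous {g g' : ℝ → ℝ → G}
    (hg : Continuous (Function.uncurry g)) (hg' : Continuous (Function.uncurry g'))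
    (hd : ∀ t σ, HasDerivAt (fun τ => g τ σ) (g' t σ) t) (a b t : ℝ) :
    HasDerivAt (fun τ => ∫ σ in a..b, g τ σ) (∫ σ in a..b, g' t σ) t := by
  obtain ⟨M, hM⟩ := ((isCompact_closedBall t 1).prod (isCompact_uIcc (a := a)
    (b := b))).exists_bound_of_continuousOn hg'.continuousOn
  have hcont : ∀ {f : ℝ → ℝ → G}, Continuous (Function.uncurry f) → ∀ τ, Continuous (f τ) :=
    fun hf τ => hf.comp (by fun_prop : Continuous fun σ : ℝ => (τ, σ))
  refine (intervalIntegral.hasDerivAt_integral_of_dominated_loc_of_deriv_le (F := g) (F' := g')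
    (bound := fun _ => M)
    (Metric.closedBall_mem_nhds t one_pos) (Eventually.of_forall fun τ =>
      (hcont hg τ).aestronglyMeasurable) ((hcont hg t).intervalIntegrable _ _)
    ((hcont hg' t).aestronglyMeasurable) ?_ intervalIntegrable_const ?_).2
  · exact Eventually.of_forall fun σ hσ τ hτ => hM (τ, σ) ⟨hτ, uIoc_subset_uIcc hσ⟩
  · exact Eventually.of_forall fun σ _ τ _ => hd τ σ

variable [CompleteSpace G]

lemma integral_sub_periodMean {g : ℝ → G} (hg : Continuous g) :
    ∫ θ in (0:ℝ)..(2 * π), (g θ - periodMean g) = 0 := by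
  rw [intervalIntegral.integral_sub (hg.intervalIntegrable _ _) intervalIntegrable_const,
    intervalIntegral.integral_const, sub_zero, periodMean, smul_smul,
    mul_inv_cancel₀ Real.two_pi_pos.ne', one_smul, sub_self]

lemma hasDerivAt_oscPrim {g : ℝ → G} (hg : Continuous g) (θ : ℝ) :
    HasDerivAt (oscPrim g) (g θ - periodMean g) θ := by
  rw [funext (oscPrim_eq g)]
  have h := (integral_hasDerivAt_right (hg.intervalIntegrable 0 θ)
    (hg.stronglyMeasurableAtFilter _ _) hg.continuousAt).sub
      ((hasDerivAt_id θ).smul_const (periodMean g))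
  rw [one_smul] at h
  exact h

lemma hasDerivAt_oscPrim_comp {g g' : ℝ → ℝ → G}
    (hg : Continuous (Function.uncurry g)) (hg' : Continuous (Function.uncurry g'))
    (hd : ∀ t σ, HasDerivAt (fun τ => g τ σ) (g' t σ) t) {φ : ℝ → ℝ} {φ' t : ℝ}
    (hφ : HasDerivAt φ φ' t) :
    HasDerivAt (fun τ => oscPrim (g τ) (φ τ))
      (oscPrim (g' t) (φ t) + φ' • (g t (φ t) - periodMean (g t))) t := by
  have hcont : ∀ {f : ℝ → ℝ → G}, Continuous (Function.uncurry f) → ∀ τ, Continuous (f τ) :=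
    fun hf τ => hf.comp (by fun_prop : Continuous fun σ : ℝ => (τ, σ))
  have h1 : ∀ r θ : ℝ, HasDerivAt (fun τ => oscPrim (g τ) θ) (oscPrim (g' r) θ) r := by
    intro r θ
    exact (hasDerivAt_integral_of_continuous hg hg' hd 0 θ r).sub
      ((hasDerivAt_integral_of_continuous hg hg' hd 0 (2 * π) r).const_smul _)
  have hc1 := continuous_oscPrim hg'
  have hc2 : Continuous fun p : ℝ × ℝ => g p.1 p.2 - periodMean (g p.1) :=
    hg.sub ((continuous_periodMean hg).comp continuous_fst)
  have key := hasStrictFDerivAt_uncurry_coprod (𝕜 := ℝ) (u := (t, φ t))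
    (f := fun r θ => oscPrim (g r) θ)
    (f₁ := fun r θ => ContinuousLinearMap.toSpanSingleton ℝ (oscPrim (g' r) θ))
    (f₂ := fun r θ => ContinuousLinearMap.toSpanSingleton ℝ (g r θ - periodMean (g r)))
    (Eventually.of_forall fun p => (h1 p.1 p.2).hasFDerivAt)
    (Eventually.of_forall fun p => (hasDerivAt_oscPrim (hcont hg p.1) p.2).hasFDerivAt)
    ((ContinuousLinearMap.toSpanSingletonCLE (𝕜 := ℝ) (E := G)).continuous.comp hc1).continuousAt
    ((ContinuousLinearMap.toSpanSingletonCLE (𝕜 := ℝ) (E := G)).continuous.comp hc2).continuousAt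
  have h2 := key.hasFDerivAt.comp_hasDerivAt t ((hasDerivAt_id t).prodMk hφ)
  simpa [Function.HasUncurry.uncurry, Function.comp_def] using! h2

/-- The integral of a mean-zero oscillation of period `2πε` tends to zero with `ε`, uniformly on
compact time intervals. -/
lemma norm_integral_oscillating_le {h : ℝ → ℝ → G} (hcont : Continuous (Function.uncurry h))
    (hper : ∀ t, Function.Periodic (h t) (2 * π))
    (hmean : ∀ t, ∫ θ in (0:ℝ)..(2 * π), h t θ = 0) (s : ℝ) {T η : ℝ} (hT : 0 < T)
    (hη : 0 < η) :
    ∃ ε₀ > 0, ∀ ε, 0 < ε → ε < ε₀ → ∀ t ∈ Icc s (s + T),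
      ‖∫ r in s..t, h r ((r - s) / ε)‖ ≤ η := by
  have hπ := Real.two_pi_pos
  obtain ⟨M, hM0, hM⟩ := exists_bound_of_periodic hπ hcont hper (s - 2 * π) (s + T)
  obtain ⟨ρ, hρ, H⟩ := exists_modulus_of_periodic hπ hcont hper (s - 2 * π) (s + T)
    (δ := η / (2 * T)) (by positivity)
  refine ⟨min 1 (min (ρ / (2 * π)) (η / (4 * (M + 1) * (2 * π)))), by positivity, ?_⟩
  intro ε hε hlt t ht
  obtain ⟨hε1, hlt⟩ := lt_min_iff.1 hlt
  obtain ⟨hε2, hε3⟩ := lt_min_iff.1 hlt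
  rw [lt_div_iff₀ hπ] at hε2
  rw [lt_div_iff₀ (by positivity)] at hε3
  set I : ℝ → G := fun φ => ∫ r in s..t, h r ((r - s) / ε + φ) with hI
  have hcI : Continuous (Function.uncurry fun φ r : ℝ => h r ((r - s) / ε + φ)) :=
    hcont.comp (by fun_prop : Continuous fun p : ℝ × ℝ => (p.2, (p.2 - s) / ε + p.1))
  have hIcont : Continuous I := continuous_parametric_intervalIntegral_of_continuous' hcI s t
  have hmeanI : ∫ φ in (0:ℝ)..(2 * π), I φ = 0 := by
    rw [hI, intervalIntegral_intervalIntegral_swap]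
    · have : ∀ r, ∫ φ in (0:ℝ)..(2 * π), h r ((r - s) / ε + φ) = 0 := by
        intro r
        rw [intervalIntegral.integral_comp_add_left (fun φ => h r φ), add_zero,
          (hper r).intervalIntegral_add_eq _ 0, zero_add, hmean]
      simp [this]
    · exact (hcI.continuousOn.integrableOn_compact
        (isCompact_uIcc.prod isCompact_uIcc)).mono_set
          (prod_mono uIoc_subset_uIcc uIoc_subset_uIcc)
  have hdiff : ∀ φ ∈ Icc 0 (2 * π), ‖I φ - I 0‖ ≤ η := by
    intro φ hφ
    have hφε : ε * φ ≤ ε * (2 * π) := by gcongr; exact hφ.2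
    have hφ0 : 0 ≤ ε * φ := mul_nonneg hε.le hφ.1
    have hφ2 : ε * φ ≤ 2 * π := hφε.trans (by nlinarith)
    set f : ℝ → G := fun u => h (u - ε * φ) ((u - s) / ε) with hf
    have hfc : Continuous f :=
      hcont.comp (by fun_prop : Continuous fun u : ℝ => (u - ε * φ, (u - s) / ε))
    have hsub : I φ = ∫ u in (s + ε * φ)..(t + ε * φ), f u := by
      rw [← intervalIntegral.integral_comp_add_right f (ε * φ)]
      refine intervalIntegral.integral_congr fun r _ => ?_
      simp only [hf, add_sub_cancel_right]
      congr 1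
      field_simp
      ring
    have hint : ∀ a b, IntervalIntegrable f volume a b := fun a b => hfc.intervalIntegrable a b
    have hint0 : IntervalIntegrable (fun r => h r ((r - s) / ε)) volume s t :=
      (hcont.comp (by fun_prop : Continuous fun r : ℝ => (r, (r - s) / ε))).intervalIntegrable _ _
    have hsplit : I φ - I 0 = (∫ u in t..(t + ε * φ), f u) - (∫ u in s..(s + ε * φ), f u)
        + ∫ u in s..t, (f u - h u ((u - s) / ε)) := by
      have e0 : I 0 = ∫ r in s..t, h r ((r - s) / ε) := by simp [hI]
      rw [hsub, e0, intervalIntegral.integral_sub (hint _ _) hint0,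
        ← integral_add_adjacent_intervals (hint (s + ε * φ) s) (hint s (t + ε * φ)),
        ← integral_add_adjacent_intervals (hint s t) (hint t (t + ε * φ)),
        intervalIntegral.integral_symm s (s + ε * φ)]
      abel
    have b1 : ∀ c ∈ Icc s (s + T), ‖∫ u in c..(c + ε * φ), f u‖ ≤ η / 4 := by
      intro c hc
      have := intervalIntegral.norm_integral_le_of_norm_le_const (f := f) (C := M)
        (a := c) (b := c + ε * φ) (by
          intro u hu
          rw [uIoc_of_le (by linarith)] at hu
          exact hM _ ⟨by linarith [hu.1, hc.1], by linarith [hu.2, hc.2]⟩ _)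
      rw [add_sub_cancel_left, abs_of_nonneg hφ0] at this
      nlinarith
    have b2 : ‖∫ u in s..t, (f u - h u ((u - s) / ε))‖ ≤ η / 2 := by
      have := intervalIntegral.norm_integral_le_of_norm_le_const
        (f := fun u => f u - h u ((u - s) / ε)) (C := η / (2 * T)) (a := s) (b := t) (by
          intro u hu
          rw [uIoc_of_le ht.1] at hu
          refine (H _ ⟨by linarith [hu.1], by linarith [hu.2, ht.2]⟩ _
            ⟨by linarith [hu.1], by linarith [hu.2, ht.2]⟩ ?_ _).le
          rw [sub_sub_cancel_left, abs_neg, abs_of_nonneg hφ0]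
          linarith)
      rw [abs_of_nonneg (sub_nonneg.2 ht.1)] at this
      calc _ ≤ η / (2 * T) * (t - s) := this
        _ ≤ η / (2 * T) * T := by gcongr; linarith [ht.2]
        _ = η / 2 := by field_simp
    rw [hsplit]
    calc _ ≤ ‖∫ u in t..(t + ε * φ), f u‖ + ‖∫ u in s..(s + ε * φ), f u‖
          + ‖∫ u in s..t, (f u - h u ((u - s) / ε))‖ :=
          (norm_add_le _ _).trans (by gcongr; exact norm_sub_le _ _)
      _ ≤ η / 4 + η / 4 + η / 2 := by
          gcongr
          exacts [b1 t ht, b1 s ⟨le_rfl, by linarith⟩]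
      _ = η := by ring
  have hfin := intervalIntegral.norm_integral_le_of_norm_le_const
    (f := fun φ => I φ - I 0) (C := η) (a := 0) (b := 2 * π) (by
      intro φ hφ
      rw [uIoc_of_le hπ.le] at hφ
      exact hdiff φ ⟨hφ.1.le, hφ.2⟩)
  rw [intervalIntegral.integral_sub (hIcont.intervalIntegrable _ _) intervalIntegrable_const,
    hmeanI, intervalIntegral.integral_const, zero_sub, norm_neg, sub_zero, norm_smul,
    Real.norm_of_nonneg hπ.le, abs_of_pos hπ, mul_comm] at hfin
  have := le_of_mul_le_mul_right hfin hπ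
  simpa [hI] using this

/-- A Gronwall estimate in which the forcing is a mean-zero fast oscillation of size `ε`, up to a
quadratic error: the solution is `o(ε)`. -/
lemma averaging_gronwall {h : ℝ → ℝ → G} (hcont : Continuous (Function.uncurry h))
    (hper : ∀ t, Function.Periodic (h t) (2 * π))
    (hmean : ∀ t, ∫ θ in (0:ℝ)..(2 * π), h t θ = 0) {s T C : ℝ} (hT : 0 < T) (hC : 0 < C)
    {w w' : ℝ → ℝ → G} (hw0 : ∀ ε, 0 < ε → w ε s = 0)
    (hderiv : ∀ ε, 0 < ε → ∀ t, HasDerivAt (w ε) (w' ε t) t)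
    (hbound : ∀ ε, 0 < ε → ε ≤ 1 → ∀ t ∈ Icc s (s + T),
      ‖w' ε t - ε • h t ((t - s) / ε)‖ ≤ C * (‖w ε t‖ + ε ^ 2)) {η : ℝ} (hη : 0 < η) :
    ∃ ε₀ > 0, ∀ ε, 0 < ε → ε < ε₀ → ∀ t ∈ Icc s (s + T), ‖w ε t‖ ≤ η * ε := by
  set B := 2 * Real.exp (C * T) with hB
  have hBpos : 0 < B := by positivity
  have hBe : Real.exp (C * T) - 1 ≤ B := by
    have := Real.exp_pos (C * T)
    linarith
  set δ := η / (1 + 2 * B) with hδ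
  have hδpos : 0 < δ := by positivity
  obtain ⟨ε₁, hε₁, H⟩ := norm_integral_oscillating_le hcont hper hmean s hT hδpos
  refine ⟨min 1 (min ε₁ δ), by positivity, fun ε hε hlt t ht => ?_⟩
  obtain ⟨hε1, hlt⟩ := lt_min_iff.1 hlt
  obtain ⟨hε2, hε3⟩ := lt_min_iff.1 hlt
  have hfc : Continuous fun r => h r ((r - s) / ε) :=
    hcont.comp (by fun_prop : Continuous fun r : ℝ => (r, (r - s) / ε))
  set J : ℝ → G := fun r => ∫ u in s..r, h u ((u - s) / ε) with hJ
  have hJd : ∀ r, HasDerivAt J (h r ((r - s) / ε)) r := fun r =>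
    integral_hasDerivAt_right (hfc.intervalIntegrable s r)
      (hfc.stronglyMeasurableAtFilter _ _) hfc.continuousAt
  have hd : ∀ r, HasDerivAt (fun r => w ε r - ε • J r) (w' ε r - ε • h r ((r - s) / ε)) r :=
    fun r => (hderiv ε hε r).sub ((hJd r).const_smul ε)
  have hg := norm_le_gronwallBound_of_norm_deriv_right_le (f := fun r => w ε r - ε • J r)
    (f' := fun r => w' ε r - ε • h r ((r - s) / ε)) (δ := 0) (K := C) (ε := C * (2 * δ * ε))
    (a := s) (b := s + T) (fun r _ => (hd r).continuousAt.continuousWithinAt)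
    (fun r _ => (hd r).hasDerivWithinAt) (by simp [hw0 ε hε, hJ]) (by
      intro r hr
      have hr' := Ico_subset_Icc_self hr
      have h1 : ‖w ε r‖ ≤ ‖w ε r - ε • J r‖ + ε * δ := by
        calc ‖w ε r‖ = ‖(w ε r - ε • J r) + ε • J r‖ := by rw [sub_add_cancel]
          _ ≤ ‖w ε r - ε • J r‖ + ‖ε • J r‖ := norm_add_le _ _
          _ ≤ _ := by
            rw [norm_smul, Real.norm_of_nonneg hε.le]
            gcongr
            exact H ε hε hε2 r hr'
      have h2 : ε ^ 2 ≤ δ * ε := by nlinarith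
      calc _ ≤ C * (‖w ε r‖ + ε ^ 2) := hbound ε hε hε1.le r hr'
        _ ≤ C * ((‖w ε r - ε • J r‖ + ε * δ) + δ * ε) := by gcongr
        _ = _ := by ring) t ht
  rw [gronwallBound_of_K_ne_0 hC.ne'] at hg
  have h3 : ‖w ε t - ε • J t‖ ≤ 2 * δ * ε * B := by
    refine hg.trans ?_
    simp only [zero_mul, zero_add]
    rw [mul_div_cancel_left₀ _ hC.ne']
    gcongr
    refine le_trans ?_ hBe
    gcongr
    linarith [ht.2]
  have h4 : ‖ε • J t‖ ≤ ε * δ := by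
    rw [norm_smul, Real.norm_of_nonneg hε.le]
    gcongr
    exact H ε hε hε2 t ht
  calc ‖w ε t‖ = ‖(w ε t - ε • J t) + ε • J t‖ := by rw [sub_add_cancel]
    _ ≤ 2 * δ * ε * B + ε * δ := (norm_add_le _ _).trans (add_le_add h3 h4)
    _ = δ * (1 + 2 * B) * ε := by ring
    _ = η * ε := by rw [hδ, div_mul_cancel₀ _ (by positivity)]

end Averaging

section Rotation

lemma Rrot_mulVec (θ : ℝ) (v : Fin 3 → ℝ) :
    (Rrot θ).mulVec v =
      ![v 0, Real.cos θ * v 1 + Real.sin θ * v 2, -Real.sin θ * v 1 + Real.cos θ * v 2] := by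
  ext i
  fin_cases i <;> simp [Rrot, Matrix.mulVec, dotProduct, Fin.sum_univ_three]

lemma scrR_mulVec (θ : ℝ) (v : Fin 3 → ℝ) :
    (scrR θ).mulVec v =
      ![0, Real.sin θ * v 1 + (1 - Real.cos θ) * v 2,
        (Real.cos θ - 1) * v 1 + Real.sin θ * v 2] := by
  ext i
  fin_cases i <;> simp [scrR, Matrix.mulVec, dotProduct, Fin.sum_univ_three]

lemma Rrot_mulVec_mulVec (a b : ℝ) (v : Fin 3 → ℝ) :
    (Rrot a).mulVec ((Rrot b).mulVec v) = (Rrot (a + b)).mulVec v := by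
  simp only [Rrot_mulVec, Real.cos_add, Real.sin_add]
  ext i
  fin_cases i <;> simp <;> ring

lemma Rrot_zero_mulVec (v : Fin 3 → ℝ) : (Rrot 0).mulVec v = v := by
  rw [Rrot_mulVec]
  ext i
  fin_cases i <;> simp

lemma Rrot_mulVec_neg (a : ℝ) (v : Fin 3 → ℝ) :
    (Rrot a).mulVec ((Rrot (-a)).mulVec v) = v := by
  rw [Rrot_mulVec_mulVec, add_neg_cancel, Rrot_zero_mulVec]

lemma scrR_zero_mulVec (v : Fin 3 → ℝ) : (scrR 0).mulVec v = 0 := by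
  rw [scrR_mulVec]
  ext i
  fin_cases i <;> simp

lemma Rrot_neg_add_two_pi (θ : ℝ) : Rrot (-(θ + 2 * π)) = Rrot (-θ) := by
  rw [show -(θ + 2 * π) = -θ - 2 * π by ring]
  simp [Rrot]

lemma scrR_add_two_pi (θ : ℝ) : scrR (θ + 2 * π) = scrR θ := by
  simp [scrR]

@[fun_prop]
lemma continuous_Rrot : Continuous Rrot := by
  refine continuous_matrix fun i j => ?_
  fin_cases i <;> fin_cases j <;> simp [Rrot] <;> fun_prop

@[fun_prop]
lemma continuous_scrR : Continuous scrR := by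
  refine continuous_matrix fun i j => ?_
  fin_cases i <;> fin_cases j <;> simp [scrR] <;> fun_prop

/-- `vpar` as a continuous linear map. -/
noncomputable def vparCLM : (Fin 3 → ℝ) →L[ℝ] (Fin 3 → ℝ) :=
  LinearMap.toContinuousLinearMap (Matrix.mulVecLin Pmat)

lemma vparCLM_apply (v : Fin 3 → ℝ) : vparCLM v = vpar v := by
  change Pmat.mulVec v = vpar v
  ext i
  fin_cases i <;> simp [Pmat, vpar, Matrix.mulVec, dotProduct, Fin.sum_univ_three]

lemma continuous_vpar : Continuous vpar := by
  rw [← funext vparCLM_apply]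
  exact vparCLM.continuous

lemma vpar_sub (u v : Fin 3 → ℝ) : vpar (u - v) = vpar u - vpar v := by
  simp [← vparCLM_apply]

lemma vpar_smul (c : ℝ) (v : Fin 3 → ℝ) : vpar (c • v) = c • vpar v := by
  simp [← vparCLM_apply]

lemma Pmat_mulVec (v : Fin 3 → ℝ) : Pmat.mulVec v = vpar v := vparCLM_apply v

lemma integral_mulVec (A : Matrix (Fin 3) (Fin 3) ℝ) {f : ℝ → Fin 3 → ℝ} (hf : Continuous f)
    (a b : ℝ) : ∫ σ in a..b, A.mulVec (f σ) = A.mulVec (∫ σ in a..b, f σ) :=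
  (LinearMap.toContinuousLinearMap (Matrix.mulVecLin A)).intervalIntegral_comp_comm
    (hf.intervalIntegrable a b)

lemma abs_apply_le (v : Fin 3 → ℝ) (i : Fin 3) : |v i| ≤ ‖v‖ := norm_le_pi_norm v i

lemma norm_vpar_le (v : Fin 3 → ℝ) : ‖vpar v‖ ≤ ‖v‖ := by
  refine (pi_norm_le_iff_of_nonneg (norm_nonneg v)).2 fun i => ?_
  fin_cases i <;> simp [vpar, abs_apply_le]

lemma norm_Rrot_mulVec_le (θ : ℝ) (v : Fin 3 → ℝ) : ‖(Rrot θ).mulVec v‖ ≤ 2 * ‖v‖ := by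
  have hc := Real.abs_cos_le_one θ
  have hs := Real.abs_sin_le_one θ
  have h0 := abs_apply_le v 0
  have h1 := abs_apply_le v 1
  have h2 := abs_apply_le v 2
  have hn := norm_nonneg v
  have mul_bd : ∀ {a b : ℝ}, |a| ≤ 1 → |b| ≤ ‖v‖ → |a * b| ≤ ‖v‖ := fun ha hb => by
    rw [abs_mul]
    exact (mul_le_mul ha hb (abs_nonneg _) zero_le_one).trans_eq (one_mul _)
  rw [Rrot_mulVec]
  refine (pi_norm_le_iff_of_nonneg (by positivity)).2 fun i => ?_
  fin_cases i
  · simp only [Real.norm_eq_abs]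
    exact h0.trans (by linarith)
  · exact (abs_add_le _ _).trans (by linarith [mul_bd hc h1, mul_bd hs h2])
  · exact (abs_add_le _ _).trans
      (by linarith [mul_bd ((abs_neg (Real.sin θ)).trans_le hs) h1, mul_bd hc h2])

lemma norm_scrR_mulVec_le (θ : ℝ) (v : Fin 3 → ℝ) : ‖(scrR θ).mulVec v‖ ≤ 3 * ‖v‖ := by
  have hs := Real.abs_sin_le_one θ
  have hc : |1 - Real.cos θ| ≤ 2 := by
    rw [abs_le]
    constructor <;> linarith [Real.cos_le_one θ, Real.neg_one_le_cos θ]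
  have h1 := abs_apply_le v 1
  have h2 := abs_apply_le v 2
  have mul_bd : ∀ {a b c : ℝ}, 0 ≤ c → |a| ≤ c → |b| ≤ ‖v‖ → |a * b| ≤ c * ‖v‖ :=
    fun hc ha hb => by
      rw [abs_mul]
      exact mul_le_mul ha hb (abs_nonneg _) hc
  rw [scrR_mulVec]
  refine (pi_norm_le_iff_of_nonneg (by positivity)).2 fun i => ?_
  fin_cases i
  · simp
  · exact (abs_add_le _ _).trans
      (by linarith [mul_bd zero_le_one hs h1, mul_bd zero_le_two hc h2])
  · exact (abs_add_le _ _).trans (by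
      linarith [mul_bd zero_le_one hs h2,
        mul_bd zero_le_two ((abs_sub_comm _ _).trans_le hc) h1])

lemma euclN_le (v : Fin 3 → ℝ) : euclN v ≤ 2 * ‖v‖ := by
  have h : ∀ i, v i ^ 2 ≤ ‖v‖ ^ 2 := fun i => sq_le_sq' (abs_le.1 (abs_apply_le v i)).1
    (abs_le.1 (abs_apply_le v i)).2
  refine Real.sqrt_le_iff.2 ⟨by positivity, ?_⟩
  nlinarith [h 0, h 1, h 2, sq_nonneg ‖v‖]

lemma hasDerivAt_apply {u : ℝ → Fin 3 → ℝ} {u' : Fin 3 → ℝ} {t : ℝ} (h : HasDerivAt u u' t)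
    (i : Fin 3) : HasDerivAt (fun r => u r i) (u' i) t := hasDerivAt_pi.1 h i

lemma HasDerivAt.Rrot_neg_mulVec {φ : ℝ → ℝ} {φ' t : ℝ} {u : ℝ → Fin 3 → ℝ} {u' : Fin 3 → ℝ}
    (hφ : HasDerivAt φ φ' t) (hu : HasDerivAt u u' t) :
    HasDerivAt (fun r => (Rrot (-φ r)).mulVec (u r))
      ((Rrot (-φ t)).mulVec (u' - φ' • cross3 (u t) ee1)) t := by
  simp only [Rrot_mulVec, Real.cos_neg, Real.sin_neg, neg_neg]
  rw [hasDerivAt_pi]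
  have h0 := hasDerivAt_apply hu 0
  have h1 := hasDerivAt_apply hu 1
  have h2 := hasDerivAt_apply hu 2
  have hc := hφ.cos
  have hs := hφ.sin
  intro i
  fin_cases i
  · refine h0.congr_deriv ?_
    simp [cross3, ee1]
  · refine ((hc.mul h1).add (hs.neg.mul h2)).congr_deriv ?_
    simp [cross3, ee1]
    ring
  · refine ((hs.mul h1).add (hc.mul h2)).congr_deriv ?_
    simp [cross3, ee1]
    ring

lemma HasDerivAt.scrR_mulVec {φ : ℝ → ℝ} {φ' t : ℝ} {u : ℝ → Fin 3 → ℝ} {u' : Fin 3 → ℝ}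
    (hφ : HasDerivAt φ φ' t) (hu : HasDerivAt u u' t) :
    HasDerivAt (fun r => (scrR (φ r)).mulVec (u r))
      (φ' • ((Rrot (φ t)).mulVec (u t) - vpar (u t)) + (scrR (φ t)).mulVec u') t := by
  simp only [_root_.scrR_mulVec, Rrot_mulVec]
  rw [hasDerivAt_pi]
  have h1 := hasDerivAt_apply hu 1
  have h2 := hasDerivAt_apply hu 2
  have hc := hφ.cos
  have hs := hφ.sin
  intro i
  fin_cases i
  · refine (hasDerivAt_const t (0:ℝ)).congr_deriv ?_
    simp [vpar]
  · refine ((hs.mul h1).add ((hc.const_sub 1).mul h2)).congr_deriv ?_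
    simp [vpar]
    ring
  · refine (((hc.sub_const 1).mul h1).add (hs.mul h2)).congr_deriv ?_
    simp [vpar]
    ring

lemma integral_scrR_mulVec (v : Fin 3 → ℝ) :
    (2 * π)⁻¹ • ∫ θ in (0:ℝ)..(2 * π), (scrR θ).mulVec v =
      (Rrot (π / 2) - Pmat).mulVec v := by
  have hd : ∀ θ : ℝ, HasDerivAt (fun r : ℝ => r • (![0, v 2, -v 1] : Fin 3 → ℝ)
      - ![0, Real.cos r * v 1 + Real.sin r * v 2, -Real.sin r * v 1 + Real.cos r * v 2])
      ((scrR θ).mulVec v) θ := by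
    intro θ
    have hs := Real.hasDerivAt_sin θ
    have hc := Real.hasDerivAt_cos θ
    rw [hasDerivAt_pi, _root_.scrR_mulVec]
    intro i
    fin_cases i
    · simpa using! hasDerivAt_const θ (0:ℝ)
    · refine (((hasDerivAt_id θ).mul_const (v 2)).sub
        ((hc.mul_const (v 1)).add (hs.mul_const (v 2)))).congr_deriv ?_
      simp
      ring
    · refine (((hasDerivAt_id θ).mul_const (-v 1)).sub
        ((hs.neg.mul_const (v 1)).add (hc.mul_const (v 2)))).congr_deriv ?_
      simp
      ring
  have hc : Continuous fun θ : ℝ => (scrR θ).mulVec v :=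
    continuous_scrR.matrix_mulVec continuous_const
  rw [integral_eq_sub_of_hasDerivAt (fun θ _ => hd θ) (hc.intervalIntegrable _ _),
    Matrix.sub_mulVec, Pmat_mulVec, Rrot_mulVec]
  have hπ := Real.two_pi_pos.ne'
  ext i
  fin_cases i
  · simp [vpar]
  · simp [vpar]
    field_simp
  · simp [vpar]
    field_simp

/-- Integration by parts, identifying the drift of the first-order guiding centre. -/
lemma periodMean_drift {e : ℝ → Fin 3 → ℝ} (he : Continuous e) :
    (2 * π)⁻¹ • (∫ θ in (0:ℝ)..(2 * π),
        ((∫ σ in (0:ℝ)..θ, (Rrot (θ - σ)).mulVec (e σ)) -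
          (θ / (2 * π)) • ∫ σ in (0:ℝ)..(2 * π), (Rrot (θ - σ)).mulVec (e σ))) -
      (Rrot (π / 2) - Pmat).mulVec
        ((2 * π)⁻¹ • ∫ ς in (0:ℝ)..(2 * π), (Rrot (-ς)).mulVec (e ς)) =
    periodMean (fun θ => vpar (oscPrim (fun σ => (Rrot (-σ)).mulVec (e σ)) θ) -
      (scrR θ).mulVec ((Rrot (-θ)).mulVec (e θ))) := by
  set g : ℝ → Fin 3 → ℝ := fun σ => (Rrot (-σ)).mulVec (e σ) with hg
  have hgc : Continuous g := (continuous_Rrot.comp continuous_neg).matrix_mulVec he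
  have hFc : Continuous (oscPrim g) :=
    continuous_iff_continuousAt.2 fun θ => (hasDerivAt_oscPrim hgc θ).continuousAt
  have hrot : ∀ θ : ℝ, (∫ σ in (0:ℝ)..θ, (Rrot (θ - σ)).mulVec (e σ)) -
      (θ / (2 * π)) • ∫ σ in (0:ℝ)..(2 * π), (Rrot (θ - σ)).mulVec (e σ)
      = (Rrot θ).mulVec (oscPrim g θ) := by
    intro θ
    have : (fun σ => (Rrot (θ - σ)).mulVec (e σ)) = fun σ => (Rrot θ).mulVec (g σ) := by
      funext σ
      rw [hg, Rrot_mulVec_mulVec, sub_eq_add_neg]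
    rw [this, integral_mulVec _ hgc, integral_mulVec _ hgc, oscPrim, Matrix.mulVec_sub,
      Matrix.mulVec_smul]
  have hd : ∀ θ : ℝ, HasDerivAt (fun r => (scrR r).mulVec (oscPrim g r))
      ((Rrot θ).mulVec (oscPrim g θ) - (vpar (oscPrim g θ) - (scrR θ).mulVec (g θ))
        - (scrR θ).mulVec (periodMean g)) θ := by
    intro θ
    refine ((hasDerivAt_id θ).scrR_mulVec (hasDerivAt_oscPrim hgc θ)).congr_deriv ?_
    simp only [id, one_smul, Matrix.mulVec_sub]
    abel
  have c1 : Continuous fun θ => (Rrot θ).mulVec (oscPrim g θ) :=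
    continuous_Rrot.matrix_mulVec hFc
  have c2 : Continuous fun θ => vpar (oscPrim g θ) - (scrR θ).mulVec (g θ) :=
    (continuous_vpar.comp hFc).sub (continuous_scrR.matrix_mulVec hgc)
  have c3 : Continuous fun θ => (scrR θ).mulVec (periodMean g) :=
    continuous_scrR.matrix_mulVec continuous_const
  have c12 : Continuous fun θ => (Rrot θ).mulVec (oscPrim g θ)
      - (vpar (oscPrim g θ) - (scrR θ).mulVec (g θ)) := c1.sub c2
  have hftc := integral_eq_sub_of_hasDerivAt (a := 0) (b := 2 * π) (fun θ _ => hd θ)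
    ((c12.sub c3).intervalIntegrable _ _)
  rw [intervalIntegral.integral_sub (c12.intervalIntegrable _ _)
    (c3.intervalIntegrable _ _), intervalIntegral.integral_sub (c1.intervalIntegrable _ _)
    (c2.intervalIntegrable _ _), oscPrim_zero, oscPrim_two_pi, Matrix.mulVec_zero,
    Matrix.mulVec_zero, sub_self] at hftc
  simp only [hrot]
  rw [show (2 * π)⁻¹ • ∫ ς in (0:ℝ)..(2 * π), (Rrot (-ς)).mulVec (e ς) = periodMean g from rfl,
    ← integral_scrR_mulVec, ← smul_sub, periodMean]
  congr 1
  rw [sub_sub, sub_eq_zero] at hftc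
  rw [hftc]
  exact add_sub_cancel_right _ _

end Rotation

section Field

variable {f : ℝ × ℝ × (Fin 3 → ℝ) → Fin 3 → ℝ}

lemma norm_zero_zero_prod (w : Fin 3 → ℝ) : ‖((0, 0, w) : ℝ × ℝ × (Fin 3 → ℝ))‖ = ‖w‖ := by
  simp [Prod.norm_def]

lemma hasFDerivAt_slice (hf : Differentiable ℝ f) (t θ : ℝ) (z : Fin 3 → ℝ) :
    HasFDerivAt (fun z => f (t, θ, z))
      ((fderiv ℝ f (t, θ, z)).comp ((ContinuousLinearMap.inr ℝ ℝ (ℝ × (Fin 3 → ℝ))).comp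
        (ContinuousLinearMap.inr ℝ ℝ (Fin 3 → ℝ)))) z :=
  (hf (t, θ, z)).hasFDerivAt.comp z
    ((hasFDerivAt_prodMk_right t (θ, z)).comp z (hasFDerivAt_prodMk_right θ z))

lemma fderiv_slice_apply (hf : Differentiable ℝ f) (t θ : ℝ) (z w : Fin 3 → ℝ) :
    fderiv ℝ (fun z => f (t, θ, z)) z w = fderiv ℝ f (t, θ, z) (0, 0, w) := by
  rw [(hasFDerivAt_slice hf t θ z).fderiv]
  rfl

lemma hasDerivAt_along_curve (hf : Differentiable ℝ f) {y : ℝ → Fin 3 → ℝ} {y' : Fin 3 → ℝ}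
    {t : ℝ} (hy : HasDerivAt y y' t) (θ : ℝ) :
    HasDerivAt (fun r => f (r, θ, y r))
      (fderiv ℝ f (t, θ, y t) (1, 0, 0) + fderiv ℝ f (t, θ, y t) (0, 0, y')) t := by
  have h := (hf (t, θ, y t)).hasFDerivAt.comp_hasDerivAt t
    ((hasDerivAt_id t).prodMk ((hasDerivAt_const t θ).prodMk hy))
  rw [← map_add]
  simpa [Function.comp_def] using! h

lemma fderiv_periodic (hp : ∀ t θ z, f (t, θ + 2 * π, z) = f (t, θ, z)) (t θ : ℝ)
    (z : Fin 3 → ℝ) : fderiv ℝ f (t, θ + 2 * π, z) = fderiv ℝ f (t, θ, z) := by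
  have h := fderiv_comp_add_right (𝕜 := ℝ) (f := f) (x := (t, θ, z)) (0, 2 * π, 0)
  have e : (fun p => f (p + (0, 2 * π, 0))) = f := by
    funext ⟨a, b, c⟩
    simpa using hp a b c
  rw [e] at h
  simpa using h.symm

lemma norm_sub_le_of_fderiv_bound (hf : Differentiable ℝ f) {L : ℝ}
    (hL : ∀ p, ‖fderiv ℝ f p‖ ≤ L) (t θ : ℝ) (z z' : Fin 3 → ℝ) :
    ‖f (t, θ, z) - f (t, θ, z')‖ ≤ L * ‖z - z'‖ := by
  have h := convex_univ.norm_image_sub_le_of_norm_fderiv_le (𝕜 := ℝ) (f := f)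
    (fun p _ => hf p) (fun p _ => hL p) (mem_univ (t, θ, z')) (mem_univ (t, θ, z))
  simpa [norm_zero_zero_prod] using h

lemma norm_taylor_le (hf : Differentiable ℝ f) {L : ℝ} (hL0 : 0 ≤ L)
    (hL : ∀ p q, ‖fderiv ℝ f p - fderiv ℝ f q‖ ≤ L * ‖p - q‖) (t θ : ℝ) (z w : Fin 3 → ℝ) :
    ‖f (t, θ, z + w) - f (t, θ, z) - fderiv ℝ f (t, θ, z) (0, 0, w)‖ ≤ L * ‖w‖ ^ 2 := by
  have h := (convex_closedBall (t, θ, z) ‖w‖).norm_image_sub_le_of_norm_fderiv_le' (𝕜 := ℝ)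
    (f := f) (φ := fderiv ℝ f (t, θ, z)) (C := L * ‖w‖) (x := (t, θ, z)) (y := (t, θ, z + w))
    (fun p _ => hf p) (fun p hp => (hL _ _).trans (by
      gcongr
      exact mem_closedBall_iff_norm.1 hp)) (Metric.mem_closedBall_self (norm_nonneg w))
    (by rw [mem_closedBall_iff_norm]; simp)
  simpa [norm_zero_zero_prod, pow_two, mul_assoc] using h

end Field

/-- A supremum over a compact time interval is bounded as soon as each of its terms is. -/
lemma tendsto_iSup_of_forall_le {s T : ℝ} (hT : 0 < T) {φ : ℝ → ℝ → ℝ} (h0 : ∀ ε t, 0 ≤ φ ε t)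
    (h : ∀ η > 0, ∃ ε₀ > 0, ∀ ε, 0 < ε → ε < ε₀ → ∀ t ∈ Icc s (s + T), φ ε t ≤ η) :
    Tendsto (fun ε => ⨆ t : Icc s (s + T), φ ε t) (nhdsWithin 0 (Ioi 0)) (nhds 0) := by
  have : Nonempty (Icc s (s + T)) := ⟨⟨s, le_rfl, by linarith⟩⟩
  rw [Metric.tendsto_nhds]
  intro η hη
  obtain ⟨ε₀, hε₀, H⟩ := h (η / 2) (by positivity)
  filter_upwards [Ioo_mem_nhdsGT hε₀] with ε hε
  rw [Real.dist_eq, sub_zero, abs_of_nonneg (Real.iSup_nonneg fun t : Icc s (s + T) => h0 ε t)]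
  exact (ciSup_le fun t : Icc s (s + T) => H ε hε.1 hε.2 t t.2).trans_lt (by linarith)

set_option maxHeartbeats 1600000 in
/-- Order-1 two-scale asymptotics for the Isotope Resonant Separation regime with a
constant strong magnetic field. -/
theorem stmt_7
    (E : ℝ → ℝ → (Fin 3 → ℝ) → (Fin 3 → ℝ))
    (hEreg : ContDiff ℝ 2 (fun p : ℝ × ℝ × (Fin 3 → ℝ) => E p.1 p.2.1 p.2.2))
    (hEbdd : ∀ k : ℕ, k ≤ 2 → ∃ C : ℝ, ∀ p : ℝ × ℝ × (Fin 3 → ℝ),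
      ‖iteratedFDeriv ℝ k (fun q : ℝ × ℝ × (Fin 3 → ℝ) => E q.1 q.2.1 q.2.2) p‖ ≤ C)
    (hEper : ∀ t θ z, E t (θ + 2 * π) z = E t θ z)
    -- the partial derivative of `E` with respect to its first (time) variable
    (Et : ℝ → ℝ → (Fin 3 → ℝ) → (Fin 3 → ℝ))
    (hEt : ∀ t θ z, HasDerivAt (fun τ : ℝ => E τ θ z) (Et t θ z) t)
    (x v : Fin 3 → ℝ) (s : ℝ)
    (X V : ℝ → ℝ → (Fin 3 → ℝ))
    (hXinit : ∀ ε : ℝ, 0 < ε → X ε s = x)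
    (hVinit : ∀ ε : ℝ, 0 < ε → V ε s = v)
    (hXode : ∀ ε : ℝ, 0 < ε → ∀ t : ℝ, HasDerivAt (X ε) (V ε t) t)
    (hVode : ∀ ε : ℝ, 0 < ε → ∀ t : ℝ, HasDerivAt (V ε)
      (E t ((t - s) / ε) (X ε t) + ε⁻¹ • cross3 (V ε t) ee1) t)
    (Y0 U0 : ℝ → (Fin 3 → ℝ))
    (hY0init : Y0 s = x) (hU0init : U0 s = v)
    (hY0ode : ∀ t : ℝ, HasDerivAt Y0 (vpar (U0 t)) t)
    (hU0ode : ∀ t : ℝ, HasDerivAt U0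
      ((2 * π)⁻¹ • ∫ θ in (0:ℝ)..(2 * π), (Rrot (-θ)).mulVec (E t θ (Y0 t))) t)
    (Y1 U1 : ℝ → (Fin 3 → ℝ))
    (hY1init : Y1 s = 0) (hU1init : U1 s = 0)
    (hY1ode : ∀ t : ℝ, HasDerivAt Y1
      (vpar (U1 t) +
        (2 * π)⁻¹ • (∫ θ in (0:ℝ)..(2 * π),
          ((∫ σ in (0:ℝ)..θ, (Rrot (θ - σ)).mulVec (E t σ (Y0 t))) -
            (θ / (2 * π)) • ∫ σ in (0:ℝ)..(2 * π), (Rrot (θ - σ)).mulVec (E t σ (Y0 t)))) -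
        (Rrot (π / 2) - Pmat).mulVec
          ((2 * π)⁻¹ • ∫ ς in (0:ℝ)..(2 * π), (Rrot (-ς)).mulVec (E t ς (Y0 t)))) t)
    (hU1ode : ∀ t : ℝ, HasDerivAt U1
      ((2 * π)⁻¹ • (∫ θ in (0:ℝ)..(2 * π),
          (Rrot (-θ)).mulVec (fderiv ℝ (fun z => E t θ z) (Y0 t) (Y1 t))) +
        (2 * π)⁻¹ • (∫ θ in (0:ℝ)..(2 * π),
          (Rrot (-θ)).mulVec
            (fderiv ℝ (fun z => E t θ z) (Y0 t) ((scrR θ).mulVec (U0 t)))) -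
        (2 * π)⁻¹ • (∫ θ in (0:ℝ)..(2 * π),
          ((∫ σ in (0:ℝ)..θ,
              (Rrot (-σ)).mulVec (fderiv ℝ (fun z => E t σ z) (Y0 t) (vpar (U0 t)))) -
            (θ / (2 * π)) • ∫ σ in (0:ℝ)..(2 * π),
              (Rrot (-σ)).mulVec (fderiv ℝ (fun z => E t σ z) (Y0 t) (vpar (U0 t))))) -
        (2 * π)⁻¹ • (∫ θ in (0:ℝ)..(2 * π),
          ((∫ σ in (0:ℝ)..θ, (Rrot (-σ)).mulVec (Et t σ (Y0 t))) -
            (θ / (2 * π)) • ∫ σ in (0:ℝ)..(2 * π), (Rrot (-σ)).mulVec (Et t σ (Y0 t))))) t) :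
    ∀ T : ℝ, 0 < T →
      Tendsto (fun ε : ℝ => ⨆ t : Icc s (s + T),
          euclN (ε⁻¹ • (X ε t.1 - Y0 t.1) -
            (Y1 t.1 + (scrR ((t.1 - s) / ε)).mulVec (U0 t.1))))
        (nhdsWithin 0 (Ioi 0)) (nhds 0) ∧
      Tendsto (fun ε : ℝ => ⨆ t : Icc s (s + T),
          euclN (ε⁻¹ • (V ε t.1 - (Rrot ((t.1 - s) / ε)).mulVec (U0 t.1)) -
            (Rrot ((t.1 - s) / ε)).mulVec
              (U1 t.1 +
                ((∫ σ in (0:ℝ)..((t.1 - s) / ε), (Rrot (-σ)).mulVec (E t.1 σ (Y0 t.1))) -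
                  (((t.1 - s) / ε) / (2 * π)) •
                    ∫ σ in (0:ℝ)..(2 * π), (Rrot (-σ)).mulVec (E t.1 σ (Y0 t.1))))))
        (nhdsWithin 0 (Ioi 0)) (nhds 0) := by
  intro T hT
  have hπ := Real.two_pi_pos
  set f : ℝ × ℝ × (Fin 3 → ℝ) → Fin 3 → ℝ := fun p => E p.1 p.2.1 p.2.2 with hf
  have hfd : Differentiable ℝ f := hEreg.differentiable (by norm_num)
  have hDf1 : ContDiff ℝ 1 (fderiv ℝ f) := hEreg.fderiv_right (by norm_num)
  obtain ⟨L, hL0, hL⟩ : ∃ L : ℝ, 0 ≤ L ∧ ∀ p, ‖fderiv ℝ f p‖ ≤ L := by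
    obtain ⟨C, hC⟩ := hEbdd 1 (by norm_num)
    refine ⟨C, (norm_nonneg _).trans (hC 0), fun p => ?_⟩
    rw [← norm_iteratedFDeriv_one]
    exact hC p
  obtain ⟨L₂, hL₂0, hL₂⟩ : ∃ L : ℝ, 0 ≤ L ∧
      ∀ p q, ‖fderiv ℝ f p - fderiv ℝ f q‖ ≤ L * ‖p - q‖ := by
    obtain ⟨C, hC⟩ := hEbdd 2 le_rfl
    refine ⟨C, (norm_nonneg _).trans (hC 0), fun p q => ?_⟩
    refine convex_univ.norm_image_sub_le_of_norm_fderiv_le (𝕜 := ℝ)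
      (fun p _ => hDf1.differentiable (by norm_num) p) (fun p _ => ?_) (mem_univ q) (mem_univ p)
    rw [← norm_iteratedFDeriv_one, norm_iteratedFDeriv_fderiv]
    exact hC p
  have hfper : ∀ t θ z, f (t, θ + 2 * π, z) = f (t, θ, z) := hEper
  have hLip : ∀ t θ z z', ‖E t θ z - E t θ z'‖ ≤ L * ‖z - z'‖ :=
    norm_sub_le_of_fderiv_bound hfd hL
  have hTaylor : ∀ t θ z w, ‖E t θ (z + w) - E t θ z - fderiv ℝ f (t, θ, z) (0, 0, w)‖ ≤
    L₂ * ‖w‖ ^ 2 := norm_taylor_le hfd hL₂0 hL₂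
  have hEt' : ∀ t θ z, Et t θ z = fderiv ℝ f (t, θ, z) (1, 0, 0) := by
    intro t θ z
    refine (hEt t θ z).unique ?_
    have h := hasDerivAt_along_curve hfd (hasDerivAt_const t z) θ
    rwa [show ((0, 0, 0) : ℝ × ℝ × (Fin 3 → ℝ)) = 0 from rfl, map_zero, add_zero] at h
  have hsl : ∀ t θ z w, fderiv ℝ (fun z => E t θ z) z w = fderiv ℝ f (t, θ, z) (0, 0, w) :=
    fderiv_slice_apply hfd
  have hY0c : Continuous Y0 := continuous_iff_continuousAt.2 fun t => (hY0ode t).continuousAt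
  have hU0c : Continuous U0 := continuous_iff_continuousAt.2 fun t => (hU0ode t).continuousAt
  have hY1c : Continuous Y1 := continuous_iff_continuousAt.2 fun t => (hY1ode t).continuousAt
  have hU1c : Continuous U1 := continuous_iff_continuousAt.2 fun t => (hU1ode t).continuousAt
  have hEc : Continuous fun p : ℝ × ℝ => E p.1 p.2 (Y0 p.1) :=
    hEreg.continuous.comp (by fun_prop : Continuous fun p : ℝ × ℝ => (p.1, p.2, Y0 p.1))
  have hDc : ∀ {u : ℝ × ℝ → ℝ × ℝ × (Fin 3 → ℝ)}, Continuous u →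
      Continuous fun p : ℝ × ℝ => fderiv ℝ f (p.1, p.2, Y0 p.1) (u p) := fun hu =>
    (hDf1.continuous.comp
      (by fun_prop : Continuous fun p : ℝ × ℝ => (p.1, p.2, Y0 p.1))).clm_apply hu
  have hRc : ∀ {u : ℝ × ℝ → Fin 3 → ℝ}, Continuous u →
      Continuous fun p : ℝ × ℝ => (Rrot (-p.2)).mulVec (u p) := fun hu =>
    (continuous_Rrot.comp (by fun_prop : Continuous fun p : ℝ × ℝ => -p.2)).matrix_mulVec hu
  have hSc : ∀ {u : ℝ × ℝ → Fin 3 → ℝ}, Continuous u →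
      Continuous fun p : ℝ × ℝ => (scrR p.2).mulVec (u p) := fun hu =>
    (continuous_scrR.comp continuous_snd).matrix_mulVec hu
  have hslice : ∀ {u : ℝ × ℝ → Fin 3 → ℝ}, Continuous u →
      ∀ t, Continuous fun θ => u (t, θ) := fun hu t =>
    hu.comp (by fun_prop : Continuous fun θ : ℝ => (t, θ))
  set g : ℝ → ℝ → Fin 3 → ℝ := fun t σ => (Rrot (-σ)).mulVec (E t σ (Y0 t)) with hg
  set gE : ℝ → ℝ → Fin 3 → ℝ := fun t σ => (Rrot (-σ)).mulVec (Et t σ (Y0 t)) with hgE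
  set gD : ℝ → ℝ → Fin 3 → ℝ := fun t σ =>
    (Rrot (-σ)).mulVec (fderiv ℝ f (t, σ, Y0 t) (0, 0, vpar (U0 t))) with hgD
  set dg : ℝ → ℝ → Fin 3 → ℝ := fun t σ => gD t σ + gE t σ with hdg
  set F : ℝ → ℝ → Fin 3 → ℝ := fun t => oscPrim (g t) with hF
  set dF : ℝ → ℝ → Fin 3 → ℝ := fun t => oscPrim (dg t) with hdF
  have hgc : Continuous (Function.uncurry g) := hRc hEc
  have hgEc : Continuous (Function.uncurry gE) := by
    simp only [hgE, hEt']
    exact hRc (hDc continuous_const)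
  have hgDc : Continuous (Function.uncurry gD) :=
    hRc (hDc (continuous_const.prodMk (continuous_const.prodMk
      ((continuous_vpar.comp hU0c).comp continuous_fst))))
  have hdgc : Continuous (Function.uncurry dg) := hgDc.add hgEc
  have hgder : ∀ t σ, HasDerivAt (fun r => g r σ) (dg t σ) t := by
    intro t σ
    have h := hasDerivAt_along_curve hfd (hY0ode t) σ
    have h2 := ((LinearMap.toContinuousLinearMap
      (Matrix.mulVecLin (Rrot (-σ)))).hasFDerivAt).comp_hasDerivAt t h
    refine h2.congr_deriv ?_
    simp only [hdg, hgD, hgE, hEt', ← Matrix.mulVec_add]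
    rw [add_comm]
    rfl
  have hgper : ∀ t, Function.Periodic (g t) (2 * π) := fun t θ => by
    simp only [hg, Rrot_neg_add_two_pi, hEper]
  have hDper : ∀ t θ z, fderiv ℝ f (t, θ + 2 * π, z) = fderiv ℝ f (t, θ, z) :=
    fderiv_periodic hfper
  have hdgper : ∀ t, Function.Periodic (dg t) (2 * π) := fun t θ => by
    simp only [hdg, hgD, hgE, hEt', Rrot_neg_add_two_pi, hDper]
  have hFper : ∀ t, Function.Periodic (F t) (2 * π) := fun t θ =>
    oscPrim_add_two_pi (hslice hgc t) (hgper t) θ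
  have hdFper : ∀ t, Function.Periodic (dF t) (2 * π) := fun t θ =>
    oscPrim_add_two_pi (hslice hdgc t) (hdgper t) θ
  have hFc : Continuous (Function.uncurry F) := continuous_oscPrim hgc
  have hdFc : Continuous (Function.uncurry dF) := continuous_oscPrim hdgc
  set q : ℝ → ℝ → Fin 3 → ℝ := fun t θ => Y1 t + (scrR θ).mulVec (U0 t) with hq
  have hqc : Continuous (Function.uncurry q) :=
    (hY1c.comp continuous_fst).add (hSc (hU0c.comp continuous_fst))
  have hqper : ∀ t, Function.Periodic (q t) (2 * π) := fun t θ => by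
    simp only [hq, scrR_add_two_pi]
  set H₁ : ℝ → ℝ → Fin 3 → ℝ := fun t θ => vpar (F t θ) - (scrR θ).mulVec (g t θ) with hH₁
  set H₂ : ℝ → ℝ → Fin 3 → ℝ := fun t θ =>
    (Rrot (-θ)).mulVec (fderiv ℝ f (t, θ, Y0 t) (0, 0, q t θ)) - dF t θ with hH₂
  have hH₁c : Continuous (Function.uncurry H₁) := (continuous_vpar.comp hFc).sub (hSc hgc)
  have hH₂c : Continuous (Function.uncurry H₂) :=
    (hRc (hDc (continuous_const.prodMk (continuous_const.prodMk hqc)))).sub hdFc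
  have hH₁per : ∀ t, Function.Periodic (H₁ t) (2 * π) := fun t θ => by
    simp only [hH₁, hFper t θ, hgper t θ, scrR_add_two_pi]
  have hH₂per : ∀ t, Function.Periodic (H₂ t) (2 * π) := fun t θ => by
    simp only [hH₂, hdFper t θ, hqper t θ, hDper, Rrot_neg_add_two_pi]
  have hY1ode' : ∀ t, HasDerivAt Y1 (vpar (U1 t) + periodMean (H₁ t)) t := by
    intro t
    refine (hY1ode t).congr_deriv ?_
    rw [add_sub_assoc, periodMean_drift (hslice hEc t)]
  have hU1ode' : ∀ t, HasDerivAt U1 (periodMean (H₂ t)) t := by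
    intro t
    refine (hU1ode t).congr_deriv ?_
    have c1 : Continuous fun θ => (Rrot (-θ)).mulVec (fderiv ℝ f (t, θ, Y0 t) (0, 0, Y1 t)) :=
      hslice (hRc (hDc (continuous_const.prodMk (continuous_const.prodMk
        (hY1c.comp continuous_fst))))) t
    have c2 : Continuous fun θ => (Rrot (-θ)).mulVec
        (fderiv ℝ f (t, θ, Y0 t) (0, 0, (scrR θ).mulVec (U0 t))) :=
      hslice (hRc (hDc (continuous_const.prodMk (continuous_const.prodMk
        (hSc (hU0c.comp continuous_fst)))))) t
    have cD : Continuous (gD t) := hslice hgDc t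
    have cE : Continuous (gE t) := hslice hgEc t
    have c3 : Continuous (oscPrim (gD t)) := hslice (continuous_oscPrim hgDc) t
    have c4 : Continuous (oscPrim (gE t)) := hslice (continuous_oscPrim hgEc) t
    have e : H₂ t = fun θ => ((Rrot (-θ)).mulVec (fderiv ℝ f (t, θ, Y0 t) (0, 0, Y1 t))
        + (Rrot (-θ)).mulVec (fderiv ℝ f (t, θ, Y0 t) (0, 0, (scrR θ).mulVec (U0 t))))
        - (oscPrim (gD t) θ + oscPrim (gE t) θ) := by
      funext θ
      simp only [hH₂, hdF, hdg, hq]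
      rw [oscPrim_add cD cE, ← Matrix.mulVec_add, ← map_add]
      simp
    have hm := (congrArg periodMean e).trans (periodMean_sub (c1.add c2) (c3.add c4))
    refine Eq.trans ?_ (hm.trans
      (congrArg₂ (· - ·) (periodMean_add c1 c2) (periodMean_add c3 c4))).symm
    simp only [hsl, ← sub_sub]
    rfl
  have hτ : ∀ ε t : ℝ, HasDerivAt (fun r => (r - s) / ε) ε⁻¹ t := fun ε t => by
    simpa using ((hasDerivAt_id t).sub_const s).div_const ε
  set U : ℝ → ℝ → Fin 3 → ℝ := fun ε t => (Rrot (-((t - s) / ε))).mulVec (V ε t) with hU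
  have hUd : ∀ ε, 0 < ε → ∀ t, HasDerivAt (U ε)
      ((Rrot (-((t - s) / ε))).mulVec (E t ((t - s) / ε) (X ε t))) t := fun ε hε t => by
    refine ((hτ ε t).Rrot_neg_mulVec (hVode ε hε t)).congr_deriv ?_
    rw [add_sub_cancel_right]
  have hVU : ∀ ε t, (Rrot ((t - s) / ε)).mulVec (U ε t) = V ε t := fun ε t =>
    Rrot_mulVec_neg _ _
  set a : ℝ → ℝ → Fin 3 → ℝ := fun ε t =>
    X ε t - ε • (scrR ((t - s) / ε)).mulVec (U ε t) - Y0 t - ε • Y1 t with ha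
  set b : ℝ → ℝ → Fin 3 → ℝ := fun ε t =>
    U ε t - U0 t - ε • U1 t - ε • F t ((t - s) / ε) with hb
  set a' : ℝ → ℝ → Fin 3 → ℝ := fun ε t =>
    vpar (U ε t) - ε • (scrR ((t - s) / ε)).mulVec
      ((Rrot (-((t - s) / ε))).mulVec (E t ((t - s) / ε) (X ε t))) - vpar (U0 t)
      - ε • (vpar (U1 t) + periodMean (H₁ t)) with ha'
  set b' : ℝ → ℝ → Fin 3 → ℝ := fun ε t =>
    (Rrot (-((t - s) / ε))).mulVec (E t ((t - s) / ε) (X ε t)) - g t ((t - s) / ε)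
      - ε • periodMean (H₂ t) - ε • dF t ((t - s) / ε) with hb'
  have had : ∀ ε, 0 < ε → ∀ t, HasDerivAt (a ε) (a' ε t) t := by
    intro ε hε t
    refine ((((hXode ε hε t).sub (((hτ ε t).scrR_mulVec (hUd ε hε t)).const_smul ε)).sub
      (hY0ode t)).sub ((hY1ode' t).const_smul ε)).congr_deriv ?_
    simp only [ha', smul_add, smul_smul, mul_inv_cancel₀ hε.ne', one_smul, hVU]
    abel
  have hbd : ∀ ε, 0 < ε → ∀ t, HasDerivAt (b ε) (b' ε t) t := by
    intro ε hε t
    refine ((((hUd ε hε t).sub (hU0ode t)).sub ((hU1ode' t).const_smul ε)).sub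
      ((hasDerivAt_oscPrim_comp hgc hdgc hgder (hτ ε t)).const_smul ε)).congr_deriv ?_
    simp only [hb', smul_add, smul_smul, mul_inv_cancel₀ hε.ne', one_smul]
    rw [show (2 * π)⁻¹ • ∫ θ in (0:ℝ)..(2 * π), (Rrot (-θ)).mulVec (E t θ (Y0 t))
      = periodMean (g t) from rfl]
    simp only [hdF]
    abel
  set h : ℝ → ℝ → (Fin 3 → ℝ) × (Fin 3 → ℝ) := fun t θ =>
    (H₁ t θ - periodMean (H₁ t), H₂ t θ - periodMean (H₂ t)) with hh
  have hhc1 : Continuous fun p : ℝ × ℝ => H₁ p.1 p.2 - periodMean (H₁ p.1) :=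
    hH₁c.sub ((continuous_periodMean hH₁c).comp continuous_fst)
  have hhc2 : Continuous fun p : ℝ × ℝ => H₂ p.1 p.2 - periodMean (H₂ p.1) :=
    hH₂c.sub ((continuous_periodMean hH₂c).comp continuous_fst)
  have hhc : Continuous (Function.uncurry h) := hhc1.prodMk hhc2
  have hhper : ∀ t, Function.Periodic (h t) (2 * π) := fun t θ => by
    simp only [hh, hH₁per t θ, hH₂per t θ]
  have hhmean : ∀ t, ∫ θ in (0:ℝ)..(2 * π), h t θ = 0 := by
    intro t
    have hi := (hhc.comp (by fun_prop : Continuous fun θ : ℝ => (t, θ))).intervalIntegrable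
      (μ := volume) 0 (2 * π)
    refine Prod.ext ?_ ?_
    · refine ((ContinuousLinearMap.fst ℝ _ _).intervalIntegral_comp_comm hi).symm.trans ?_
      exact integral_sub_periodMean (hslice hH₁c t)
    · refine ((ContinuousLinearMap.snd ℝ _ _).intervalIntegral_comp_comm hi).symm.trans ?_
      exact integral_sub_periodMean (hslice hH₂c t)
  obtain ⟨Q₁, hQ₁0, hQ₁⟩ := exists_bound_of_periodic hπ hqc hqper s (s + T)
  obtain ⟨Q₂, hQ₂0, hQ₂⟩ := exists_bound_of_periodic (h := fun t θ => U1 t + F t θ) hπ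
    ((hU1c.comp continuous_fst).add hFc) (fun t θ => by simp only [hFper t θ]) s (s + T)
  have hUU0 : ∀ ε t, U ε t - U0 t = b ε t + ε • (U1 t + F t ((t - s) / ε)) := fun ε t => by
    simp only [hb, smul_add]
    abel
  have hXZ : ∀ ε t, X ε t - (Y0 t + ε • q t ((t - s) / ε)) =
      a ε t + ε • (scrR ((t - s) / ε)).mulVec (U ε t - U0 t) := fun ε t => by
    simp only [ha, hq, smul_add, Matrix.mulVec_sub, smul_sub]
    abel
  have hscr : ∀ ε, 0 < ε → ∀ t ∈ Icc s (s + T), ∀ B, ‖b ε t‖ ≤ B →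
      ‖(scrR ((t - s) / ε)).mulVec (U ε t - U0 t)‖ ≤ 3 * (B + ε * Q₂) := by
    intro ε hε t ht B hB
    refine (norm_scrR_mulVec_le _ _).trans ?_
    rw [hUU0]
    gcongr
    refine (norm_add_le _ _).trans ?_
    rw [norm_smul, Real.norm_of_nonneg hε.le]
    gcongr
    exact hQ₂ t ht _
  have hsmall : ∀ η > 0, ∃ ε₀ > 0, ∀ ε, 0 < ε → ε < ε₀ → ∀ t ∈ Icc s (s + T),
      ‖(a ε t, b ε t)‖ ≤ η * ε := by
    intro η hη
    refine averaging_gronwall (w := fun ε t => (a ε t, b ε t))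
      (w' := fun ε t => (a' ε t, b' ε t)) hhc hhper hhmean hT
      (C := 1 + 24 * L * (1 + Q₁ + Q₂) + 2 * L₂ * Q₁ ^ 2) (by positivity) ?_
      (fun ε hε t => (had ε hε t).prodMk (hbd ε hε t)) ?_ hη
    · intro ε hε
      refine Prod.ext ?_ ?_
      · simp only [ha, zero_div, hXinit ε hε, hY0init, hY1init, scrR_zero_mulVec, smul_zero, sub_zero,
          sub_self, Prod.fst_zero]
      · simp only [hb, hU, hF, zero_div, neg_zero, hVinit ε hε, hU0init, hU1init, Rrot_zero_mulVec,
          oscPrim_zero, smul_zero, sub_self, Prod.snd_zero]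
    · intro ε hε hε1 t ht
      set w := ‖(a ε t, b ε t)‖ with hw
      set τ := (t - s) / ε with hτdef
      have hw0 : 0 ≤ w := norm_nonneg _
      have haw : ‖a ε t‖ ≤ w := norm_fst_le (a ε t, b ε t)
      have hbw : ‖b ε t‖ ≤ w := norm_snd_le (a ε t, b ε t)
      have hZ : ‖X ε t - (Y0 t + ε • q t τ)‖ ≤ 4 * w + 3 * Q₂ * ε ^ 2 := by
        rw [hXZ]
        have h1 := hscr ε hε t ht w hbw
        have h2 : ‖ε • (scrR τ).mulVec (U ε t - U0 t)‖ ≤ ε * (3 * (w + ε * Q₂)) := by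
          rw [norm_smul, Real.norm_of_nonneg hε.le]
          gcongr
        have h3 := norm_add_le (a ε t) (ε • (scrR τ).mulVec (U ε t - U0 t))
        nlinarith [mul_le_of_le_one_left hw0 hε1]
      have hqn : ‖ε • q t τ‖ ≤ ε * Q₁ := by
        rw [norm_smul, Real.norm_of_nonneg hε.le]
        gcongr
        exact hQ₁ t ht _
      have hXY : ‖X ε t - Y0 t‖ ≤ 4 * w + 3 * Q₂ * ε ^ 2 + ε * Q₁ := by
        rw [show X ε t - Y0 t = (X ε t - (Y0 t + ε • q t τ)) + ε • q t τ by abel]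
        exact (norm_add_le _ _).trans (add_le_add hZ hqn)
      have hfst : a' ε t - ε • (H₁ t τ - periodMean (H₁ t)) = vpar (b ε t)
          - ε • (scrR τ).mulVec ((Rrot (-τ)).mulVec (E t τ (X ε t) - E t τ (Y0 t))) := by
        simp only [ha', hb, hH₁, hg, vpar_sub, vpar_smul, smul_add, smul_sub, Matrix.mulVec_sub]
        abel
      have hsnd : b' ε t - ε • (H₂ t τ - periodMean (H₂ t)) =
          (Rrot (-τ)).mulVec ((E t τ (X ε t) - E t τ (Y0 t + ε • q t τ))
            + (E t τ (Y0 t + ε • q t τ) - E t τ (Y0 t)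
              - fderiv ℝ f (t, τ, Y0 t) (0, 0, ε • q t τ))) := by
        have e : ((0, 0, ε • q t τ) : ℝ × ℝ × (Fin 3 → ℝ)) = ε • (0, 0, q t τ) := by simp
        rw [e, map_smul]
        simp only [hb', hH₂, hg, smul_sub, Matrix.mulVec_sub, Matrix.mulVec_add,
          Matrix.mulVec_smul]
        abel
      have b1 : ‖a' ε t - ε • (H₁ t τ - periodMean (H₁ t))‖ ≤
          w + ε * (3 * (2 * (L * (4 * w + 3 * Q₂ * ε ^ 2 + ε * Q₁)))) := by
        rw [hfst]
        refine (norm_sub_le _ _).trans ?_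
        rw [norm_smul, Real.norm_of_nonneg hε.le]
        gcongr
        · exact (norm_vpar_le _).trans hbw
        · refine (norm_scrR_mulVec_le _ _).trans ?_
          gcongr
          refine (norm_Rrot_mulVec_le _ _).trans ?_
          gcongr
          refine (hLip _ _ _ _).trans ?_
          gcongr
      have b2 : ‖b' ε t - ε • (H₂ t τ - periodMean (H₂ t))‖ ≤
          2 * (L * (4 * w + 3 * Q₂ * ε ^ 2) + L₂ * (ε * Q₁) ^ 2) := by
        rw [hsnd]
        refine (norm_Rrot_mulVec_le _ _).trans ?_
        gcongr
        refine (norm_add_le _ _).trans ?_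
        gcongr
        · refine (hLip _ _ _ _).trans ?_
          gcongr
        · refine (hTaylor _ _ _ _).trans ?_
          gcongr
      have hwe : ε * w ≤ w := mul_le_of_le_one_left hw0 hε1
      have hεε : ε * ε ^ 2 ≤ ε ^ 2 := mul_le_of_le_one_left (sq_nonneg ε) hε1
      refine (norm_prod_le_iff.2 ⟨b1.trans ?_, b2.trans ?_⟩)
      · calc w + ε * (3 * (2 * (L * (4 * w + 3 * Q₂ * ε ^ 2 + ε * Q₁))))
            = w + 24 * L * (ε * w) + 18 * L * Q₂ * (ε * ε ^ 2) + 6 * L * Q₁ * ε ^ 2 := by ring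
          _ ≤ w + 24 * L * w + 18 * L * Q₂ * ε ^ 2 + 6 * L * Q₁ * ε ^ 2 := by gcongr
          _ ≤ w + 24 * L * w + 18 * L * Q₂ * ε ^ 2 + 6 * L * Q₁ * ε ^ 2
              + (24 * L * (Q₁ + Q₂) * w + 2 * L₂ * Q₁ ^ 2 * w + ε ^ 2 + 24 * L * ε ^ 2
                + 6 * L * Q₂ * ε ^ 2 + 18 * L * Q₁ * ε ^ 2 + 2 * L₂ * Q₁ ^ 2 * ε ^ 2) :=
              le_add_of_nonneg_right (by positivity)
          _ = _ := by ring
      · calc 2 * (L * (4 * w + 3 * Q₂ * ε ^ 2) + L₂ * (ε * Q₁) ^ 2)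
            = 8 * L * w + 6 * L * Q₂ * ε ^ 2 + 2 * L₂ * Q₁ ^ 2 * ε ^ 2 := by ring
          _ ≤ 8 * L * w + 6 * L * Q₂ * ε ^ 2 + 2 * L₂ * Q₁ ^ 2 * ε ^ 2
              + (w + 16 * L * w + 24 * L * (Q₁ + Q₂) * w + 2 * L₂ * Q₁ ^ 2 * w + ε ^ 2
                + 24 * L * ε ^ 2 + 18 * L * Q₂ * ε ^ 2 + 24 * L * Q₁ * ε ^ 2) :=
              le_add_of_nonneg_right (by positivity)
          _ = _ := by ring
  constructor
  · refine tendsto_iSup_of_forall_le hT (φ := fun ε t => euclN (ε⁻¹ • (X ε t - Y0 t) -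
            (Y1 t + (scrR ((t - s) / ε)).mulVec (U0 t)))) (fun _ _ => Real.sqrt_nonneg _) ?_
    intro η hη
    obtain ⟨ε₀, hε₀, H⟩ := hsmall (η / 16) (by positivity)
    refine ⟨min 1 (min ε₀ (η / (16 * (Q₂ + 1)))), by positivity, fun ε hε hlt t ht => ?_⟩
    obtain ⟨hε1, hlt⟩ := lt_min_iff.1 hlt
    obtain ⟨hε2, hε3⟩ := lt_min_iff.1 hlt
    rw [lt_div_iff₀ (by positivity)] at hε3
    have hab := H ε hε hε2 t ht
    have haw : ‖a ε t‖ ≤ η / 16 * ε := (norm_fst_le (a ε t, b ε t)).trans hab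
    have hbw : ‖b ε t‖ ≤ η / 16 * ε := (norm_snd_le (a ε t, b ε t)).trans hab
    have e : ε⁻¹ • (X ε t - Y0 t) - (Y1 t + (scrR ((t - s) / ε)).mulVec (U0 t)) =
        ε⁻¹ • a ε t + (scrR ((t - s) / ε)).mulVec (U ε t - U0 t) := by
      have h1 := congrArg (fun y => ε⁻¹ • y) (hXZ ε t)
      simp only [smul_add, smul_sub, smul_smul, inv_mul_cancel₀ hε.ne', one_smul] at h1
      rw [← h1]
      simp only [hq, smul_sub]
      abel
    have h1 : ‖ε⁻¹ • a ε t‖ ≤ η / 16 := by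
      rw [norm_smul, Real.norm_of_nonneg (inv_nonneg.2 hε.le), inv_mul_le_iff₀ hε, mul_comm]
      exact haw
    have h2 := hscr ε hε t ht _ hbw
    refine (euclN_le _).trans ?_
    rw [e]
    have h3 := norm_add_le (ε⁻¹ • a ε t) ((scrR ((t - s) / ε)).mulVec (U ε t - U0 t))
    nlinarith [mul_pos hη (sub_pos.2 hε1)]
  · refine tendsto_iSup_of_forall_le hT (φ := fun ε t =>
      euclN (ε⁻¹ • (V ε t - (Rrot ((t - s) / ε)).mulVec (U0 t)) -
        (Rrot ((t - s) / ε)).mulVec (U1 t +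
          ((∫ σ in (0:ℝ)..((t - s) / ε), (Rrot (-σ)).mulVec (E t σ (Y0 t))) -
            (((t - s) / ε) / (2 * π)) •
              ∫ σ in (0:ℝ)..(2 * π), (Rrot (-σ)).mulVec (E t σ (Y0 t))))))
      (fun _ _ => Real.sqrt_nonneg _) ?_
    intro η hη
    obtain ⟨ε₀, hε₀, H⟩ := hsmall (η / 4) (by positivity)
    refine ⟨ε₀, hε₀, fun ε hε hlt t ht => ?_⟩
    have hbw : ‖b ε t‖ ≤ η / 4 * ε := (norm_snd_le (a ε t, b ε t)).trans (H ε hε hlt t ht)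
    have e : ε⁻¹ • (V ε t - (Rrot ((t - s) / ε)).mulVec (U0 t)) -
        (Rrot ((t - s) / ε)).mulVec (U1 t + F t ((t - s) / ε)) =
        (Rrot ((t - s) / ε)).mulVec (ε⁻¹ • b ε t) := by
      rw [← hVU ε t, ← Matrix.mulVec_sub, hUU0, Matrix.mulVec_smul, Matrix.mulVec_add,
        Matrix.mulVec_smul, smul_add, smul_smul, inv_mul_cancel₀ hε.ne', one_smul,
        add_sub_cancel_right]
    have h1 : ‖ε⁻¹ • b ε t‖ ≤ η / 4 := by
      rw [norm_smul, Real.norm_of_nonneg (inv_nonneg.2 hε.le), inv_mul_le_iff₀ hε, mul_comm]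
      exact hbw
    have h2 := norm_Rrot_mulVec_le ((t - s) / ε) (ε⁻¹ • b ε t)
    rw [← e] at h2
    have h3 := h2.trans (mul_le_mul_of_nonneg_left h1 zero_le_two)
    refine (euclN_le _).trans ?_
    exact (mul_le_mul_of_nonneg_left h3 zero_le_two).trans (by linarith)
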